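/- arXiv:2410.08492 — 2 statements merged into one kernel-verified Lean document; each statement's English description precedes it below -/
import Mathlib

section
/- Closed form of the auxiliary function h in the paper's derivation of the Dirichlet integral: for every real α > 0, the function t ↦ e^{−αt} (sin t)/t is Lebesgue integrable on [0, ∞) and h(α) = ∫₀^∞ e^{−αt} (sin t)/t dt = π/2 − arctan α. -/
open Real MeasureTheory

lemma aux_inner (α : ℝ) (hα : 0 < α) (s : ℝ) :
    ∫ t in Set.Ioi (0 : ℝ), Real.exp (-α * t) * Real.cos (s * t) = α / (α ^ 2 + s ^ 2) := by
  have ha : ((-α : ℂ) + s * Complex.I).re < 0 := by simpa using hα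
  have h1 := integral_exp_mul_complex_Ioi ha 0
  have h2 := integrableOn_exp_mul_complex_Ioi ha 0
  have h3 : ∀ t : ℝ, Real.exp (-α * t) * Real.cos (s * t)
      = RCLike.re (Complex.exp (((-α : ℂ) + s * Complex.I) * t)) := by
    intro t
    simp [Complex.exp_re]
  simp_rw [h3]
  rw [integral_re h2, h1]
  simp [Complex.div_re, Complex.normSq_apply]
  ring

lemma aux_sinc (t : ℝ) (ht : 0 < t) :
    ∫ s in Set.Ioc (0 : ℝ) 1, Real.cos (s * t) = Real.sin t / t := by
  rw [← intervalIntegral.integral_of_le zero_le_one]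
  rw [intervalIntegral.integral_comp_mul_right _ ht.ne']
  simp [div_eq_inv_mul]

lemma aux_outer (α : ℝ) (hα : 0 < α) :
    ∫ s in Set.Ioc (0 : ℝ) 1, α / (α ^ 2 + s ^ 2) = Real.pi / 2 - Real.arctan α := by
  rw [← intervalIntegral.integral_of_le zero_le_one, ← Real.arctan_inv_of_pos hα]
  have hd : ∀ s ∈ Set.uIcc (0 : ℝ) 1,
      HasDerivAt (fun s : ℝ => Real.arctan (s / α)) (α / (α ^ 2 + s ^ 2)) s := by
    intro s _
    have h := ((hasDerivAt_id s).div_const α).arctan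
    have he : 1 / (1 + (s / α) ^ 2) * (1 / α) = α / (α ^ 2 + s ^ 2) := by
      have : α ^ 2 + s ^ 2 ≠ 0 := by positivity
      field_simp
    rw [← he]
    exact h
  rw [intervalIntegral.integral_eq_sub_of_hasDerivAt hd]
  · simp
  · apply Continuous.intervalIntegrable
    exact continuous_const.div (by fun_prop) (fun s => by positivity)

/-- Closed form of the auxiliary function `h`: for `α > 0`, `t ↦ e^{−αt} (sin t)/t`
is integrable on `[0, ∞)` and `h(α) = ∫₀^∞ e^{−αt} (sin t)/t dt = π/2 − arctan α`. -/
theorem auxiliary_h_closed_form (α : ℝ) (hα : 0 < α) :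
    IntegrableOn (fun t : ℝ => Real.exp (-α * t) * (Real.sin t / t)) (Set.Ici 0) ∧
      ∫ t in Set.Ici (0 : ℝ), Real.exp (-α * t) * (Real.sin t / t) =
        Real.pi / 2 - Real.arctan α := by
  rw [integrableOn_Ici_iff_integrableOn_Ioi, integral_Ici_eq_integral_Ioi]
  have hexp : IntegrableOn (fun t : ℝ => Real.exp (-α * t)) (Set.Ioi 0) :=
    integrableOn_exp_mul_Ioi (by linarith) 0
  have hF : Integrable (Function.uncurry fun t s : ℝ => Real.exp (-α * t) * Real.cos (s * t))
      ((volume.restrict (Set.Ioi 0)).prod (volume.restrict (Set.Ioc (0 : ℝ) 1))) := by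
    have h1 : Integrable (fun _ : ℝ => (1 : ℝ)) (volume.restrict (Set.Ioc (0 : ℝ) 1)) :=
      integrable_const _
    refine (hexp.integrable.mul_prod h1).mono ?_ (Filter.Eventually.of_forall ?_)
    · apply Continuous.aestronglyMeasurable
      unfold Function.uncurry
      fun_prop
    · rintro ⟨t, s⟩
      simp only [Function.uncurry, norm_mul, norm_one]
      exact mul_le_mul_of_nonneg_left (Real.abs_cos_le_one _) (norm_nonneg _)
  have hEq : ∀ t ∈ Set.Ioi (0 : ℝ),
      ∫ s in Set.Ioc (0 : ℝ) 1, Real.exp (-α * t) * Real.cos (s * t)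
        = Real.exp (-α * t) * (Real.sin t / t) := by
    intro t ht
    rw [integral_const_mul, aux_sinc t ht]
  constructor
  · exact IntegrableOn.congr_fun hF.integral_prod_left hEq measurableSet_Ioi
  · rw [← setIntegral_congr_fun measurableSet_Ioi hEq, integral_integral_swap hF]
    simp_rw [aux_inner α hα]
    exact aux_outer α hα
end

section
/- Abelian limit step in the paper's derivation of the Dirichlet integral: the limit as α → 0⁺ of h(α) = ∫₀^∞ e^{−αt} (sin t)/t dt exists and equals the improper integral lim_{T→∞} ∫₀^T (sin t)/t dt; in particular both limits equal π/2. -/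
open Real MeasureTheory Filter

lemma aux_exp (c a b : ℝ) (hc : c ≠ 0) :
    ∫ x in a..b, Real.exp (-x * c) = (Real.exp (-a * c) - Real.exp (-b * c)) / c := by
  have h : ∀ x ∈ Set.uIcc a b,
      HasDerivAt (fun x : ℝ => -Real.exp (-x * c) / c) (Real.exp (-x * c)) x := by
    intro x _
    have h1 : HasDerivAt (fun x : ℝ => -x * c) (-1 * c) x := ((hasDerivAt_id x).neg).mul_const c
    refine (h1.exp.neg.div_const c).congr_deriv ?_
    field_simp
  rw [intervalIntegral.integral_eq_sub_of_hasDerivAt h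
    (Continuous.intervalIntegrable (by fun_prop) _ _)]
  ring

lemma aux_exp_sin (x T : ℝ) :
    ∫ t in (0:ℝ)..T, Real.exp (-x * t) * Real.sin t =
      (1 + x ^ 2)⁻¹ - Real.exp (-x * T) * (x * Real.sin T + Real.cos T) / (1 + x ^ 2) := by
  have h : ∀ t ∈ Set.uIcc 0 T,
      HasDerivAt (fun t : ℝ => -(Real.exp (-x * t) * (x * Real.sin t + Real.cos t)) / (1 + x ^ 2))
        (Real.exp (-x * t) * Real.sin t) t := by
    intro t _
    have h1 : HasDerivAt (fun t : ℝ => -x * t) (-x * 1) t := (hasDerivAt_id t).const_mul (-x)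
    have h2 := ((Real.hasDerivAt_sin t).const_mul x).add (Real.hasDerivAt_cos t)
    have hx : 1 + x ^ 2 ≠ 0 := by positivity
    refine ((h1.exp.mul h2).neg.div_const (1 + x ^ 2)).congr_deriv ?_
    simp only [Pi.add_apply]
    field_simp
    ring
  rw [intervalIntegral.integral_eq_sub_of_hasDerivAt h
    (Continuous.intervalIntegrable (by fun_prop) _ _)]
  simp
  ring

lemma aux_sinc_ae (a T : ℝ) :
    ∫ t in (0:ℝ)..T, Real.exp (-a * t) * (Real.sin t / t) =
      ∫ t in (0:ℝ)..T, Real.exp (-a * t) * Real.sinc t := by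
  refine intervalIntegral.integral_congr_ae ?_
  have : ∀ᵐ t : ℝ, t ≠ 0 := by simp [ae_iff]
  filter_upwards [this] with t ht _
  rw [Real.sinc_of_ne_zero ht]

lemma aux_swap (a B T : ℝ) :
    (∫ t in (0:ℝ)..T, Real.exp (-a * t) * (Real.sin t / t)) -
      (∫ t in (0:ℝ)..T, Real.exp (-B * t) * (Real.sin t / t)) =
    ∫ x in a..B, ∫ t in (0:ℝ)..T, Real.exp (-x * t) * Real.sin t := by
  have hcont : Continuous (Function.uncurry fun x t : ℝ => Real.exp (-x * t) * Real.sin t) := by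
    fun_prop
  have hint : IntegrableOn (Function.uncurry fun x t : ℝ => Real.exp (-x * t) * Real.sin t)
      (Set.uIoc a B ×ˢ Set.uIoc 0 T) := by
    refine IntegrableOn.mono_set (t := Set.uIcc a B ×ˢ Set.uIcc 0 T) ?_
      (Set.prod_mono Set.uIoc_subset_uIcc Set.uIoc_subset_uIcc)
    exact hcont.continuousOn.integrableOn_compact (isCompact_uIcc.prod isCompact_uIcc)
  rw [intervalIntegral_intervalIntegral_swap hint, aux_sinc_ae, aux_sinc_ae,
    ← intervalIntegral.integral_sub (Continuous.intervalIntegrable (by fun_prop) _ _)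
      (Continuous.intervalIntegrable (by fun_prop) _ _)]
  refine intervalIntegral.integral_congr_ae ?_
  have : ∀ᵐ t : ℝ, t ≠ 0 := by simp [ae_iff]
  filter_upwards [this] with t ht _
  rw [Real.sinc_of_ne_zero ht, intervalIntegral.integral_mul_const, aux_exp _ _ _ ht]
  ring

lemma aux_bound (a T : ℝ) (ha : 0 ≤ a) (hT : 0 < T) :
    |(∫ t in (0:ℝ)..T, Real.exp (-a * t) * (Real.sin t / t)) - (π / 2 - Real.arctan a)| ≤ 1 / T := by
  have key : ∀ B : ℝ, 0 < B → a ≤ B →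
      |(∫ t in (0:ℝ)..T, Real.exp (-a * t) * (Real.sin t / t)) -
        (Real.arctan B - Real.arctan a)| ≤ 1 / B + 1 / T := by
    intro B hB haB
    have h1 := aux_swap a B T
    simp_rw [aux_exp_sin] at h1
    have hc1 : Continuous fun x : ℝ => (1 + x ^ 2)⁻¹ :=
      Continuous.inv₀ (by fun_prop) (fun x => by positivity)
    have hc2 : Continuous fun x : ℝ =>
        Real.exp (-x * T) * (x * Real.sin T + Real.cos T) / (1 + x ^ 2) :=
      Continuous.div (by fun_prop) (by fun_prop) (fun x => by positivity)
    rw [intervalIntegral.integral_sub (hc1.intervalIntegrable _ _) (hc2.intervalIntegrable _ _)] at h1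
    have h2 : ∫ x in a..B, (1 + x ^ 2 : ℝ)⁻¹ = Real.arctan B - Real.arctan a := by
      simp
    rw [h2] at h1
    have h3 : |∫ x in a..B, Real.exp (-x * T) * (x * Real.sin T + Real.cos T) / (1 + x ^ 2)|
        ≤ 1 / T := by
      calc _ ≤ ∫ x in a..B, Real.exp (-x * T) := by
            rw [← Real.norm_eq_abs]
            refine intervalIntegral.norm_integral_le_of_norm_le haB
              (Eventually.of_forall fun x _ => ?_)
              (Continuous.intervalIntegrable (by fun_prop) _ _)
            rw [Real.norm_eq_abs, abs_div, abs_mul, abs_of_pos (Real.exp_pos _),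
              abs_of_pos (by positivity : (0:ℝ) < 1 + x ^ 2), div_le_iff₀ (by positivity)]
            refine mul_le_mul_of_nonneg_left ?_ (Real.exp_pos _).le
            refine abs_le_of_sq_le_sq ?_ (by positivity)
            nlinarith [sq_nonneg (x * Real.cos T - Real.sin T), Real.sin_sq_add_cos_sq T,
              sq_nonneg x, sq_nonneg (x ^ 2)]
        _ ≤ 1 / T := by
            rw [aux_exp _ _ _ hT.ne']
            refine div_le_div_of_nonneg_right ?_ hT.le
            have : Real.exp (-a * T) ≤ 1 := Real.exp_le_one_iff.2 (by nlinarith)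
            linarith [Real.exp_pos (-B * T)]
    have h4 : |∫ t in (0:ℝ)..T, Real.exp (-B * t) * (Real.sin t / t)| ≤ 1 / B := by
      calc _ ≤ ∫ t in (0:ℝ)..T, Real.exp (-t * B) := by
            rw [← Real.norm_eq_abs, aux_sinc_ae]
            refine intervalIntegral.norm_integral_le_of_norm_le hT.le
              (Eventually.of_forall fun t _ => ?_)
              (Continuous.intervalIntegrable (by fun_prop) _ _)
            rw [Real.norm_eq_abs, abs_mul, abs_of_pos (Real.exp_pos _),
              show -t * B = -B * t by ring]
            exact mul_le_of_le_one_right (Real.exp_pos _).le (Real.abs_sinc_le_one t)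
        _ ≤ 1 / B := by
            rw [aux_exp _ _ _ hB.ne']
            refine div_le_div_of_nonneg_right ?_ hB.le
            have := Real.exp_pos (-T * B)
            simp
            simpa using this.le
    rw [abs_le] at h3 h4 ⊢
    constructor <;> linarith [h3.1, h3.2, h4.1, h4.2]
  have hl : Tendsto (fun B : ℝ => |(∫ t in (0:ℝ)..T, Real.exp (-a * t) * (Real.sin t / t)) -
        (Real.arctan B - Real.arctan a)|) atTop
      (nhds |(∫ t in (0:ℝ)..T, Real.exp (-a * t) * (Real.sin t / t)) -
        (π / 2 - Real.arctan a)|) := by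
    have : Tendsto Real.arctan atTop (nhds (π / 2)) :=
      tendsto_nhds_of_tendsto_nhdsWithin Real.tendsto_arctan_atTop
    exact (tendsto_const_nhds.sub (this.sub_const _)).abs
  have hr : Tendsto (fun B : ℝ => 1 / B + 1 / T) atTop (nhds (0 + 1 / T)) := by
    have h0 : Tendsto (fun B : ℝ => 1 / B) atTop (nhds 0) := by
      simp only [one_div]
      exact tendsto_inv_atTop_zero (𝕜 := ℝ)
    exact h0.add_const _
  rw [zero_add] at hr
  refine le_of_tendsto_of_tendsto hl hr ?_
  filter_upwards [eventually_gt_atTop 0, eventually_ge_atTop a] with B h1 h2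
  exact key B h1 h2

lemma aux_tendsto (a : ℝ) (ha : 0 ≤ a) :
    Tendsto (fun T : ℝ => ∫ t in (0:ℝ)..T, Real.exp (-a * t) * (Real.sin t / t)) atTop
      (nhds (π / 2 - Real.arctan a)) := by
  rw [tendsto_iff_norm_sub_tendsto_zero]
  have hr : Tendsto (fun T : ℝ => 1 / T) atTop (nhds 0) := by
    simp only [one_div]
    exact tendsto_inv_atTop_zero (𝕜 := ℝ)
  refine squeeze_zero' (Eventually.of_forall fun _ => norm_nonneg _) ?_ hr
  filter_upwards [eventually_gt_atTop 0] with T hT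
  exact aux_bound a T ha hT

lemma aux_integral (a : ℝ) (ha : 0 < a) :
    ∫ t in Set.Ici (0 : ℝ), Real.exp (-a * t) * (Real.sin t / t) = π / 2 - Real.arctan a := by
  rw [integral_Ici_eq_integral_Ioi]
  refine tendsto_nhds_unique (intervalIntegral_tendsto_integral_Ioi 0 ?_ tendsto_id)
    (aux_tendsto a ha.le)
  refine Integrable.mono' (exp_neg_integrableOn_Ioi 0 ha)
    (Measurable.aestronglyMeasurable (by fun_prop)) ?_
  filter_upwards [ae_restrict_mem measurableSet_Ioi] with t ht
  have ht' : t ≠ 0 := ne_of_gt ht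
  rw [Real.norm_eq_abs, abs_mul, abs_of_pos (Real.exp_pos _), ← Real.sinc_of_ne_zero ht']
  exact mul_le_of_le_one_right (Real.exp_pos _).le (Real.abs_sinc_le_one t)

/-- Abelian limit step in the derivation of the Dirichlet integral: the limit as `α → 0⁺`
of `h(α) = ∫₀^∞ e^{−αt} (sin t)/t dt` exists and equals the improper integral
`lim_{T→∞} ∫₀^T (sin t)/t dt`; both limits equal `π/2`. -/
theorem abelian_limit_step :
    Tendsto (fun α : ℝ => ∫ t in Set.Ici (0 : ℝ), Real.exp (-α * t) * (Real.sin t / t))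
      (nhdsWithin 0 (Set.Ioi 0)) (nhds (Real.pi / 2)) ∧
    Tendsto (fun T : ℝ => ∫ t in (0 : ℝ)..T, Real.sin t / t) atTop (nhds (Real.pi / 2)) := by
  constructor
  · have h : Tendsto (fun a : ℝ => π / 2 - Real.arctan a) (nhdsWithin 0 (Set.Ioi 0))
        (nhds (π / 2)) := by
      have hc : Continuous fun a : ℝ => π / 2 - Real.arctan a :=
        continuous_const.sub Real.continuous_arctan
      have := hc.tendsto 0
      simp only [Real.arctan_zero, sub_zero] at this
      exact this.mono_left nhdsWithin_le_nhds
    refine h.congr' ?_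
    filter_upwards [self_mem_nhdsWithin] with a ha
    exact (aux_integral a ha).symm
  · simpa using aux_tendsto 0 le_rfl
end
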